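/- (Theorem 2, roof property) Let Φ be a positive trace-preserving real-linear map on Hermitian 2×2 matrices, w ∈ ℝ, and suppose the real symmetric 4×4 matrix Q_w of the quadratic form q_w(x) = Φ(x)·Φ(x) − w x·x is positive semidefinite with nontrivial kernel containing a nonzero vector n with n·n ≤ 0. Then for every qubit state ρ with vector x there exist at most two pure states π₁, π₂ (vectors y, z with y₀ = z₀ = 1, y·y = z·z = 0) and p ∈ [0,1] with ρ = p·π₁ + (1−p)·π₂ and √(q_w(x)) = p·√(q_w(y)) + (1−p)·√(q_w(z)). -/

import Mathlib

open scoped Matrix ComplexOrder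
open Matrix

noncomputable section

/-- Pauli matrix σ₁ -/
def pauli1 : Matrix (Fin 2) (Fin 2) ℂ := !![0, 1; 1, 0]
/-- Pauli matrix σ₂ -/
def pauli2 : Matrix (Fin 2) (Fin 2) ℂ := !![0, -Complex.I; Complex.I, 0]
/-- Pauli matrix σ₃ -/
def pauli3 : Matrix (Fin 2) (Fin 2) ℂ := !![1, 0; 0, -1]

/-- The map x ↦ ½(x₀ I + x₁σ₁ + x₂σ₂ + x₃σ₃). -/
def toMat (x : Fin 4 → ℝ) : Matrix (Fin 2) (Fin 2) ℂ :=
  (1 / 2 : ℂ) • ((x 0 : ℂ) • (1 : Matrix (Fin 2) (Fin 2) ℂ) +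
    (x 1 : ℂ) • pauli1 + (x 2 : ℂ) • pauli2 + (x 3 : ℂ) • pauli3)

/-- Minkowski inner product on ℝ⁴. -/
def mink (x y : Fin 4 → ℝ) : ℝ := x 0 * y 0 - x 1 * y 1 - x 2 * y 2 - x 3 * y 3

/-- Bloch-picture action of a trace-preserving linear map:
(x₀, x⃗) ↦ (x₀, x₀ t⃗ + Λ x⃗). -/
def phiVec (t : Fin 3 → ℝ) (Λ : Matrix (Fin 3) (Fin 3) ℝ) (x : Fin 4 → ℝ) : Fin 4 → ℝ :=
  ![x 0,
    x 0 * t 0 + ∑ j : Fin 3, Λ 0 j * x j.succ,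
    x 0 * t 1 + ∑ j : Fin 3, Λ 1 j * x j.succ,
    x 0 * t 2 + ∑ j : Fin 3, Λ 2 j * x j.succ]

/-- The quadratic form q_w(x) = Φ(x)·Φ(x) − w x·x. -/
def qform (t : Fin 3 → ℝ) (Λ : Matrix (Fin 3) (Fin 3) ℝ) (w : ℝ) (x : Fin 4 → ℝ) : ℝ :=
  mink (phiVec t Λ x) (phiVec t Λ x) - w * mink x x

/-- Positivity of the map in the Bloch picture: positive semidefinite matrices are
mapped to positive semidefinite matrices. -/
def IsPosMap (t : Fin 3 → ℝ) (Λ : Matrix (Fin 3) (Fin 3) ℝ) : Prop :=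
  ∀ x : Fin 4 → ℝ, (toMat x).PosSemidef → (toMat (phiVec t Λ x)).PosSemidef

/-- x is the Bloch vector of a qubit state. -/
def IsStateVec (x : Fin 4 → ℝ) : Prop := (toMat x).PosSemidef ∧ x 0 = 1

/-- x is the Bloch vector of a pure qubit state (determinant zero, i.e. x·x = 0). -/
def IsPureVec (x : Fin 4 → ℝ) : Prop := (toMat x).PosSemidef ∧ x 0 = 1 ∧ mink x x = 0

/-- Concurrence of a pure state: C_Φ(π) = 2√(det Φ(π)). -/
def pureConc (t : Fin 3 → ℝ) (Λ : Matrix (Fin 3) (Fin 3) ℝ) (y : Fin 4 → ℝ) : ℝ :=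
  2 * Real.sqrt ((toMat (phiVec t Λ y)).det.re)

/-- Concurrence of a (mixed) state with Bloch vector x: the infimum over finite
convex decompositions into pure states of the average pure-state concurrence. -/
def conc (t : Fin 3 → ℝ) (Λ : Matrix (Fin 3) (Fin 3) ℝ) (x : Fin 4 → ℝ) : ℝ :=
  sInf {c : ℝ | ∃ (k : ℕ) (p : Fin k → ℝ) (y : Fin k → (Fin 4 → ℝ)),
    (∀ j, 0 < p j) ∧ (∑ j, p j) = 1 ∧ (∀ j, IsPureVec (y j)) ∧
    (∀ i, (∑ j, p j * y j i) = x i) ∧ c = ∑ j, p j * pureConc t Λ (y j)}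

end

theorem det_toMat (x : Fin 4 → ℝ) : (toMat x).det = ((mink x x / 4 : ℝ) : ℂ) := by
  simp [toMat, pauli1, pauli2, pauli3, mink, det_fin_two]
  linear_combination (x 2 : ℂ) ^ 2 / 4 * Complex.I_sq

theorem toMat_isHermitian (x : Fin 4 → ℝ) : (toMat x).IsHermitian := by
  ext i j
  fin_cases i <;> fin_cases j <;> simp [toMat, pauli1, pauli2, pauli3] <;> ring

theorem mink_self_nonneg_of_posSemidef {x : Fin 4 → ℝ} (hx : (toMat x).PosSemidef) :
    0 ≤ mink x x := by
  have h := hx.det_nonneg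
  rw [det_toMat, Complex.zero_le_real] at h
  linarith

theorem toMat_mul_self {x : Fin 4 → ℝ} (h0 : x 0 = 1) (hx : mink x x = 0) :
    toMat x * toMat x = toMat x := by
  have h : (x 1 : ℂ) ^ 2 + (x 2 : ℂ) ^ 2 + (x 3 : ℂ) ^ 2 = 1 := by
    norm_cast
    simp only [mink, h0] at hx
    linarith
  ext i j
  fin_cases i <;> fin_cases j <;>
    simp [toMat, pauli1, pauli2, pauli3, mul_apply, Fin.sum_univ_two, h0]
  · linear_combination h / 4 - (x 2 : ℂ) ^ 2 / 4 * Complex.I_sq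
  · ring
  · ring
  · linear_combination h / 4 - (x 2 : ℂ) ^ 2 / 4 * Complex.I_sq

theorem isPureVec_of_mink_self_eq_zero {x : Fin 4 → ℝ} (h0 : x 0 = 1) (hx : mink x x = 0) :
    IsPureVec x := by
  refine ⟨?_, h0, hx⟩
  have h := posSemidef_conjTranspose_mul_self (toMat x)
  rwa [(toMat_isHermitian x).eq, toMat_mul_self h0 hx] at h

theorem exists_roots_of_neg_of_nonneg {a c : ℝ} (b : ℝ) (ha : a < 0) (hc : 0 ≤ c) :
    ∃ r s : ℝ, r ≤ 0 ∧ 0 ≤ s ∧ a * r ^ 2 + 2 * b * r + c = 0 ∧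
      a * s ^ 2 + 2 * b * s + c = 0 := by
  have ha' := ha.ne
  have hD : 0 ≤ b ^ 2 - a * c := by nlinarith [sq_nonneg b]
  have habs : |b| ≤ √(b ^ 2 - a * c) := Real.abs_le_sqrt (by nlinarith)
  obtain ⟨h₁, h₂⟩ := abs_le.mp habs
  have hsq := Real.sq_sqrt hD
  refine ⟨(-b + √(b ^ 2 - a * c)) / a, (-b - √(b ^ 2 - a * c)) / a,
    div_nonpos_of_nonneg_of_nonpos (by linarith) ha.le,
    div_nonneg_of_nonpos (by linarith) ha.le, ?_, ?_⟩ <;>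
  · field_simp
    linear_combination hsq

theorem exists_weight_of_nonpos_of_nonneg {r s : ℝ} (hr : r ≤ 0) (hs : 0 ≤ s) :
    ∃ p : ℝ, 0 ≤ p ∧ p ≤ 1 ∧ p * r + (1 - p) * s = 0 := by
  rcases (sub_nonneg.mpr (hr.trans hs)).eq_or_lt with h | h
  · exact ⟨1, zero_le_one, le_rfl, by linarith⟩
  · refine ⟨s / (s - r), div_nonneg hs h.le, (div_le_one h).mpr (by linarith), ?_⟩
    field_simp
    ring

theorem dotProduct_mulVec_smul_add_smul_of_mulVec_eq_zero {ι : Type*} [Fintype ι]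
    {Q : Matrix ι ι ℝ} (hQ : Q.IsSymm) {n : ι → ℝ} (hn : Q *ᵥ n = 0) (x : ι → ℝ) (a b : ℝ) :
    (a • x + b • n) ⬝ᵥ Q *ᵥ (a • x + b • n) = a ^ 2 * (x ⬝ᵥ Q *ᵥ x) := by
  have h : n ⬝ᵥ Q *ᵥ x = 0 := by
    rw [dotProduct_mulVec, ← mulVec_transpose, hQ.eq, hn, zero_dotProduct]
  simp only [mulVec_add, mulVec_smul, hn, smul_zero, add_zero, add_dotProduct, smul_dotProduct,
    dotProduct_smul, h, smul_eq_mul]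
  ring

theorem mink_self_neg_of_zero_time {d : Fin 4 → ℝ} (h0 : d 0 = 0) (hd : d ≠ 0) :
    mink d d < 0 := by
  by_contra! h
  simp only [mink, h0] at h
  apply hd
  ext i
  fin_cases i
  · exact h0
  all_goals
    simp only [Pi.zero_apply]
    apply pow_eq_zero_iff two_ne_zero |>.mp
    simp only [Fin.mk_one, Fin.reduceFinMk]
    nlinarith [sq_nonneg (d 1), sq_nonneg (d 2), sq_nonneg (d 3)]

theorem mink_self_add_smul (x d : Fin 4 → ℝ) (s : ℝ) :
    mink (x + s • d) (x + s • d) = mink d d * s ^ 2 + 2 * mink x d * s + mink x x := by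
  simp only [mink, Pi.add_apply, Pi.smul_apply, smul_eq_mul]
  ring

/-- On the line through a vector `x` of the closed Bloch ball and a point proportional to `n`, the
points of the Bloch sphere do not lie beyond the latter. -/
theorem mul_le_one_of_mink_self_eq_zero {n x : Fin 4 → ℝ} {c s : ℝ} (hnn : mink n n ≤ 0)
    (hx : 0 ≤ mink x x) (hd : mink (n - c • x) (n - c • x) < 0)
    (hs : mink (x + s • (n - c • x)) (x + s • (n - c • x)) = 0) : s * c ≤ 1 := by
  by_contra! h
  have hs0 : s ≠ 0 := by
    rintro rfl
    norm_num at h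
  have key : s ^ 2 * mink n n = s * c * (s * c - 1) * mink x x +
      (s * c - 1) * (s ^ 2 * -mink (n - c • x) (n - c • x)) +
      s * c * mink (x + s • (n - c • x)) (x + s • (n - c • x)) := by
    simp only [mink, Pi.add_apply, Pi.sub_apply, Pi.smul_apply, smul_eq_mul]
    ring
  have h₁ : 0 ≤ s * c * (s * c - 1) * mink x x :=
    mul_nonneg (mul_nonneg (by linarith) (by linarith)) hx
  have h₂ : 0 < (s * c - 1) * (s ^ 2 * -mink (n - c • x) (n - c • x)) :=
    mul_pos (by linarith) (mul_pos (by positivity) (by linarith))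
  have h₃ : s ^ 2 * mink n n ≤ 0 := mul_nonpos_of_nonneg_of_nonpos (sq_nonneg s) hnn
  rw [hs] at key
  linarith

/-- Theorem 2, roof property: if Q_w is positive semidefinite with a
nonzero kernel vector n with n·n ≤ 0, then every qubit state ρ admits a decomposition
into at most two pure states on which √q_w is the convex average:
√(q_w(x)) = p √(q_w(y)) + (1−p) √(q_w(z)). -/
theorem stmt7 (t : Fin 3 → ℝ) (Λ : Matrix (Fin 3) (Fin 3) ℝ) (hpos : IsPosMap t Λ)
    (w : ℝ) (Q : Matrix (Fin 4) (Fin 4) ℝ) (hsymm : Q.IsSymm)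
    (hrepr : ∀ y : Fin 4 → ℝ, y ⬝ᵥ Q.mulVec y = qform t Λ w y)
    (hpsd : Q.PosSemidef)
    (n : Fin 4 → ℝ) (hn : n ≠ 0) (hker : Q.mulVec n = 0) (hnn : mink n n ≤ 0)
    (x : Fin 4 → ℝ) (hx : IsStateVec x) :
    ∃ (p : ℝ) (y z : Fin 4 → ℝ), 0 ≤ p ∧ p ≤ 1 ∧
      IsPureVec y ∧ IsPureVec z ∧
      x = p • y + (1 - p) • z ∧
      Real.sqrt (qform t Λ w x) =
        p * Real.sqrt (qform t Λ w y) + (1 - p) * Real.sqrt (qform t Λ w z) := by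
  obtain ⟨hxpsd, hx0⟩ := hx
  have hC := mink_self_nonneg_of_posSemidef hxpsd
  by_cases hd : n - n 0 • x = 0
  · have hnx : n = n 0 • x := sub_eq_zero.mp hd
    have hn0 : n 0 ≠ 0 := by
      intro h
      rw [h, zero_smul] at hnx
      exact hn hnx
    have hmink : mink n n = n 0 ^ 2 * mink x x := by
      conv_lhs => rw [hnx]
      simp only [mink, Pi.smul_apply, smul_eq_mul]
      ring
    have hxx : mink x x = 0 := by
      have : 0 < n 0 ^ 2 := by positivity
      nlinarith
    have hpure := isPureVec_of_mink_self_eq_zero hx0 hxx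
    exact ⟨1, x, x, zero_le_one, le_rfl, hpure, hpure, by simp, by simp⟩
  · have hd0 : (n - n 0 • x) 0 = 0 := by simp [hx0]
    have hA := mink_self_neg_of_zero_time hd0 hd
    obtain ⟨r, s, hr, hs, hfr, hfs⟩ :=
      exists_roots_of_neg_of_nonneg (mink x (n - n 0 • x)) hA hC
    rw [← mink_self_add_smul] at hfr hfs
    obtain ⟨p, hp0, hp1, hp⟩ := exists_weight_of_nonpos_of_nonneg hr hs
    have hsqrt : ∀ u : ℝ, mink (x + u • (n - n 0 • x)) (x + u • (n - n 0 • x)) = 0 →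
        √(qform t Λ w (x + u • (n - n 0 • x))) = (1 - u * n 0) * √(qform t Λ w x) := by
      intro u hu
      have hle := mul_le_one_of_mink_self_eq_zero hnn hC hA hu
      have hline : x + u • (n - n 0 • x) = (1 - u * n 0) • x + u • n := by
        module
      rw [← hrepr, ← hrepr, hline,
        dotProduct_mulVec_smul_add_smul_of_mulVec_eq_zero hsymm hker,
        Real.sqrt_mul (sq_nonneg _), Real.sqrt_sq (by linarith)]
    have hpure : ∀ u : ℝ, mink (x + u • (n - n 0 • x)) (x + u • (n - n 0 • x)) = 0 →
        IsPureVec (x + u • (n - n 0 • x)) := fun u hu =>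
      isPureVec_of_mink_self_eq_zero (by rw [Pi.add_apply, Pi.smul_apply, hd0, hx0]; simp) hu
    refine ⟨p, _, _, hp0, hp1, hpure r hfr, hpure s hfs, ?_, ?_⟩
    · calc x = x + (p * r + (1 - p) * s) • (n - n 0 • x) := by rw [hp, zero_smul, add_zero]
        _ = _ := by module
    · rw [hsqrt r hfr, hsqrt s hfs]
      linear_combination n 0 * √(qform t Λ w x) * hp
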